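/- (Lemma 1) For every constant c > 0, ∫_{0}^{∞} e^{-z} ln(1 + c z) dz ≥ ln(1 + c e^{-γ}), where γ is the Euler–Mascheroni constant. Equivalently, if Z is exponentially distributed with unit rate, then E[log₂(1 + c Z)] ≥ log₂(1 + c e^{-γ}). -/

import Mathlib

open MeasureTheory Real

/-- The derivative of the Gamma function at `1`, as an integral. -/
theorem integral_exp_neg_mul_log_Ioi :
    ∫ z in Set.Ioi (0 : ℝ), Real.exp (-z) * Real.log z = -Real.eulerMascheroniConstant := by
  have hGamma : Complex.GammaIntegral =ᶠ[nhds 1] Complex.Gamma := by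
    have hre : ∀ᶠ s : ℂ in nhds 1, 0 < s.re :=
      Complex.continuous_re.continuousAt.eventually_const_lt (by simp)
    filter_upwards [hre] with s hs using (Complex.Gamma_eq_integral hs).symm
  have hderiv := (Complex.hasDerivAt_GammaIntegral (s := 1) (by simp)).unique
    (Complex.hasDerivAt_Gamma_one.congr_of_eventuallyEq hGamma)
  have hcongr : ∫ t : ℝ in Set.Ioi 0, (t : ℂ) ^ ((1 : ℂ) - 1) * (Real.log t * Real.exp (-t)) =
      ∫ t : ℝ in Set.Ioi 0, ((Real.exp (-t) * Real.log t : ℝ) : ℂ) := by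
    congr 1 with t
    simp [mul_comm]
  rw [hcongr, integral_complex_ofReal] at hderiv
  exact_mod_cast hderiv

theorem integrableOn_exp_neg_mul_log_Ioi :
    IntegrableOn (fun z : ℝ => Real.exp (-z) * Real.log z) (Set.Ioi 0) := by
  by_contra h
  have h_zero := integral_exp_neg_mul_log_Ioi.symm.trans (integral_undef h)
  linarith [Real.one_half_lt_eulerMascheroniConstant]

theorem integrableOn_exp_neg_mul_log_one_add_mul_Ioi {c : ℝ} (hc : 0 ≤ c) :
    IntegrableOn (fun z : ℝ => Real.exp (-z) * Real.log (1 + c * z)) (Set.Ioi 0) := by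
  have hz : IntegrableOn (fun z : ℝ => Real.exp (-z) * z) (Set.Ioi 0) := by
    have := Real.GammaIntegral_convergent (s := 2) (by norm_num)
    norm_num at this
    exact this
  refine (hz.mul_const c).mono' (by fun_prop) ?_
  filter_upwards [ae_restrict_mem measurableSet_Ioi] with z hz
  have hcz : 0 ≤ c * z := mul_nonneg hc (le_of_lt hz)
  rw [norm_mul, Real.norm_of_nonneg (Real.exp_pos _).le,
    Real.norm_of_nonneg (Real.log_nonneg (by linarith)), mul_assoc, mul_comm z]
  gcongr
  linarith [Real.log_le_sub_one_of_pos (show 0 < 1 + c * z by linarith)]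

/-- The function `u ↦ log (1 + c * exp u)` lies above its tangent line at `log w`. -/
theorem log_one_add_mul_ge_tangent {c w z : ℝ} (hc : 0 < c) (hw : 0 < w) (hz : 0 < z) :
    Real.log (1 + c * w) + c * w / (1 + c * w) * (Real.log z - Real.log w) ≤
      Real.log (1 + c * z) := by
  have hcw : 0 < 1 + c * w := by positivity
  have hconc := strictConcaveOn_log_Ioi.concaveOn.2 (Set.mem_Ioi.2 one_pos)
    (Set.mem_Ioi.2 (div_pos hz hw)) (show 0 ≤ 1 / (1 + c * w) by positivity)
    (show 0 ≤ c * w / (1 + c * w) by positivity) (by field_simp)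
  have hmean : 1 / (1 + c * w) * 1 + c * w / (1 + c * w) * (z / w) =
      (1 + c * z) / (1 + c * w) := by
    field_simp
  simp only [smul_eq_mul, Real.log_one, mul_zero, zero_add] at hconc
  rw [hmean, Real.log_div hz.ne' hw.ne', Real.log_div (by positivity) hcw.ne'] at hconc
  linarith

theorem log_one_add_mul_exp_neg_eulerMascheroniConstant_le {c : ℝ} (hc : 0 < c) :
    Real.log (1 + c * Real.exp (-Real.eulerMascheroniConstant)) ≤
      ∫ z in Set.Ioi (0 : ℝ), Real.exp (-z) * Real.log (1 + c * z) := by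
  set w := Real.exp (-Real.eulerMascheroniConstant)
  set p := c * w / (1 + c * w)
  have hlogw : Real.log w = -Real.eulerMascheroniConstant := Real.log_exp _
  have hexp : IntegrableOn (fun z : ℝ => Real.exp (-z)) (Set.Ioi 0) :=
    integrableOn_exp_neg_Ioi 0
  have hconst := hexp.mul_const (Real.log (1 + c * w) - p * Real.log w)
  have hlog := integrableOn_exp_neg_mul_log_Ioi.mul_const p
  calc
    Real.log (1 + c * w) = ∫ z in Set.Ioi (0 : ℝ),
        (Real.exp (-z) * (Real.log (1 + c * w) - p * Real.log w) +
          Real.exp (-z) * Real.log z * p) := by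
      rw [integral_add hconst hlog, integral_mul_const, integral_mul_const,
        integral_exp_neg_Ioi_zero, integral_exp_neg_mul_log_Ioi, hlogw]
      ring
    _ ≤ _ := by
      refine setIntegral_mono_on (hconst.add hlog)
        (integrableOn_exp_neg_mul_log_one_add_mul_Ioi hc.le) measurableSet_Ioi fun z hz => ?_
      have htangent := log_one_add_mul_ge_tangent hc (Real.exp_pos _ : 0 < w) hz
      have := mul_le_mul_of_nonneg_left htangent (Real.exp_pos (-z)).le
      linarith

/-- (Lemma 1) For every `c > 0`,
`∫_{0}^{∞} e^{-z} ln (1 + c z) dz ≥ ln (1 + c e^{-γ})`, where `γ` is the Euler–Mascheroni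
constant; equivalently, in base-2 logarithms,
`∫_{0}^{∞} e^{-z} log₂ (1 + c z) dz ≥ log₂ (1 + c e^{-γ})`. -/
theorem lemma1_rate_lower_bound (c : ℝ) (hc : 0 < c) :
    (∫ z in Set.Ioi (0 : ℝ), Real.exp (-z) * Real.log (1 + c * z)
        ≥ Real.log (1 + c * Real.exp (-Real.eulerMascheroniConstant))) ∧
    (∫ z in Set.Ioi (0 : ℝ), Real.exp (-z) * Real.logb 2 (1 + c * z)
        ≥ Real.logb 2 (1 + c * Real.exp (-Real.eulerMascheroniConstant))) := by
  have h := log_one_add_mul_exp_neg_eulerMascheroniConstant_le hc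
  refine ⟨h, ?_⟩
  simp only [Real.logb, ← mul_div_assoc, integral_div]
  gcongr
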